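/- arXiv:1311.6938 — 4 statements merged into one kernel-verified Lean document; each statement's English description precedes it below -/
import Mathlib

section
/- Let v : [0,2π] → ℝ be a function that is C¹ on the closure of each cell τ_j (its one-sided values v(x_{j-1/2}^+), v(x_{j+1/2}^-) on τ_j given by the piece on τ_j, and v(x_{j-1/2}^-) for j ≥ 2 given by the piece on τ_{j-1}), and let v₀ ∈ ℝ, with the convention v(x_{1/2}^-) := v₀. Then Σ_{j=1}^N [ −∫_{τ_j} v v' dx + v(x_{j+1/2}^-)² − v(x_{j-1/2}^-) v(x_{j-1/2}^+) ] = (1/2) Σ_{j=1}^N ( v(x_{j-1/2}^+) − v(x_{j-1/2}^-) )² + (1/2) ( v(x_{N+1/2}^-)² − v₀² ). In particular, if v₀ = 0 or v₀ = v(x_{N+1/2}^-), then Σ_{j=1}^N [ −∫_{τ_j} v v' dx + v(x_{j+1/2}^-)² − v(x_{j-1/2}^-) v(x_{j-1/2}^+) ] ≥ 0. -/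
open MeasureTheory intervalIntegral

/-- Legendre polynomial of degree `m` via the Rodrigues formula. -/
noncomputable def legendreP (m : ℕ) : ℝ → ℝ :=
  fun s => (1 / ((2:ℝ) ^ m * (Nat.factorial m : ℝ))) *
    iteratedDeriv m (fun t : ℝ => (t ^ 2 - 1) ^ m) s

/-- Legendre polynomial rescaled to the cell `(a, b)`. -/
noncomputable def legendreCell (m : ℕ) (a b : ℝ) : ℝ → ℝ :=
  fun x => legendreP m ((2 * x - (a + b)) / (b - a))

/-- `P` is the Gauss–Radau projection (onto polynomials of degree ≤ k on `(a,b)`) of `u`. -/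
def IsGRProj (k : ℕ) (a b : ℝ) (u : ℝ → ℝ) (P : Polynomial ℝ) : Prop :=
  P.natDegree ≤ k ∧
  (∀ v : Polynomial ℝ, v.natDegree + 1 ≤ k →
    (∫ x in a..b, P.eval x * v.eval x) = ∫ x in a..b, u x * v.eval x) ∧
  P.eval b = u b

/-- The scaled primitive `(D⁻¹ v)(x) = (2/(b-a)) ∫_a^x v`. -/
noncomputable def Dinv (a b : ℝ) (v : ℝ → ℝ) : ℝ → ℝ :=
  fun x => (2 / (b - a)) * ∫ t in a..x, v t

/-- `F` is the sequence of correction polynomials on the cell `(a,b)`: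
`F 1 = P_h^-(D⁻¹ L_k)` and `F i = -P_h^-(D⁻¹ F (i-1))` for `i ≥ 2`. -/
def IsFSeq (k : ℕ) (a b : ℝ) (F : ℕ → Polynomial ℝ) : Prop :=
  IsGRProj k a b (Dinv a b (legendreCell k a b)) (F 1) ∧
  ∀ i, 2 ≤ i → IsGRProj k a b (Dinv a b (fun x => (F (i-1)).eval x)) (-(F i))

/-- The `m`-th Radau coefficient of `w` on the cell `(a,b)`. -/
noncomputable def radauCoeff (a b : ℝ) (w : ℝ → ℝ) (m : ℕ) : ℝ :=
  w b - (1 / (b - a)) *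
    ∫ x in a..b, w x * ∑ l ∈ Finset.range m, (2 * (l:ℝ) + 1) * legendreCell l a b x

/-- `G_i(t) = (d/dt)^i u_{j,k+1}(t)` for `u(x,t) = u0(x - t)` on the cell `(a,b)`. -/
noncomputable def Gfun (k : ℕ) (a b : ℝ) (u0 : ℝ → ℝ) (i : ℕ) (t : ℝ) : ℝ :=
  iteratedDeriv i (fun s => radauCoeff a b (fun y => u0 (y - s)) (k + 1)) t

/-- `w_i(x,t) = (h_j/2)^i G_i(t) F_i(x)` on the cell `(a,b)`. -/
noncomputable def wFun (k : ℕ) (a b : ℝ) (u0 : ℝ → ℝ) (F : ℕ → Polynomial ℝ)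
    (i : ℕ) (y t : ℝ) : ℝ :=
  ((b - a) / 2) ^ i * Gfun k a b u0 i t * (F i).eval y

/-- `w^l = Σ_{i=1}^l w_i` on the cell `(a,b)`. -/
noncomputable def wSum (k : ℕ) (a b : ℝ) (u0 : ℝ → ℝ) (F : ℕ → Polynomial ℝ)
    (l : ℕ) (y t : ℝ) : ℝ :=
  ∑ i ∈ Finset.Icc 1 l, wFun k a b u0 F i y t

/-- The interpolation function `u_I^l = P_h^- u - w^l` on the cell `(a,b)`;
here `P t` is the Gauss–Radau projection of `u(·,t)`. -/
noncomputable def uIl (k : ℕ) (a b : ℝ) (u0 : ℝ → ℝ) (P : ℝ → Polynomial ℝ)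
    (F : ℕ → Polynomial ℝ) (l : ℕ) (y t : ℝ) : ℝ :=
  (P t).eval y - wSum k a b u0 F l y t

/-- `uh` is a DG solution on `[0,T]` on the mesh `x 0 < x 1 < … < x N`
(the piece on the cell `τ_j = (x (j-1), x j)` is the polynomial `uh j t`),
with prescribed inflow value `inflow t` at the left boundary. -/
def IsDGSol (k N : ℕ) (x : ℕ → ℝ) (T : ℝ) (inflow : ℝ → ℝ)
    (uh : ℕ → ℝ → Polynomial ℝ) : Prop :=
  (∀ j ∈ Finset.Icc 1 N, ∀ t : ℝ, (uh j t).natDegree ≤ k) ∧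
  (∀ j ∈ Finset.Icc 1 N, ∀ y : ℝ, ContDiff ℝ 1 (fun t => (uh j t).eval y)) ∧
  (∀ j ∈ Finset.Icc 1 N, ∀ t ∈ Set.Icc (0:ℝ) T, ∀ v : Polynomial ℝ, v.natDegree ≤ k →
    (∫ y in (x (j-1))..(x j), deriv (fun s => (uh j s).eval y) t * v.eval y)
      - (∫ y in (x (j-1))..(x j), (uh j t).eval y * v.derivative.eval y)
      + (uh j t).eval (x j) * v.eval (x j)
      - (if j = 1 then inflow t else (uh (j-1) t).eval (x (j-1))) * v.eval (x (j-1)) = 0)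

/-- The error `u - u_I^l` on the cell `τ_j`, as a function of `(y, s)`. -/
noncomputable def errFun (k l : ℕ) (x : ℕ → ℝ) (u0 : ℝ → ℝ)
    (P : ℕ → ℝ → Polynomial ℝ) (F : ℕ → ℕ → Polynomial ℝ) (j : ℕ) (y s : ℝ) : ℝ :=
  u0 (y - s) - uIl k (x (j-1)) (x j) u0 (P j) (F j) l y s

/-- the cell-summed DG bilinear identity and its nonnegativity consequence. -/
theorem stmt0 (N : ℕ) (x : ℕ → ℝ) (hN : 1 ≤ N) (hx0 : x 0 = 0)
    (hxN : x N = 2 * Real.pi) (hmono : ∀ j < N, x j < x (j+1))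
    (v : ℕ → ℝ → ℝ) (hv : ∀ j ∈ Finset.Icc 1 N, ContDiff ℝ 1 (v j))
    (v0 : ℝ) :
    ((∑ j ∈ Finset.Icc 1 N,
        (-(∫ y in (x (j-1))..(x j), v j y * deriv (v j) y)
          + (v j (x j))^2
          - (if j = 1 then v0 else v (j-1) (x (j-1))) * v j (x (j-1))))
      = (1/2) * (∑ j ∈ Finset.Icc 1 N,
          (v j (x (j-1)) - (if j = 1 then v0 else v (j-1) (x (j-1))))^2)
        + (1/2) * ((v N (x N))^2 - v0^2))
    ∧ ((v0 = 0 ∨ v0 = v N (x N)) →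
        0 ≤ ∑ j ∈ Finset.Icc 1 N,
          (-(∫ y in (x (j-1))..(x j), v j y * deriv (v j) y)
            + (v j (x j))^2
            - (if j = 1 then v0 else v (j-1) (x (j-1))) * v j (x (j-1)))) := by
  have hint : ∀ j ∈ Finset.Icc 1 N, (∫ y in (x (j-1))..(x j), v j y * deriv (v j) y)
      = (1/2) * ((v j (x j))^2 - (v j (x (j-1)))^2) := by
    intro j hj
    have hc := hv j hj
    have hd : Differentiable ℝ (v j) := hc.differentiable (by norm_num)
    have hcd : Continuous (deriv (v j)) := hc.continuous_deriv (by norm_num)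
    have h := intervalIntegral.integral_eq_sub_of_hasDerivAt
      (a := x (j-1)) (b := x j) (f := fun y => (1/2) * (v j y)^2)
      (f' := fun y => v j y * deriv (v j) y)
      (fun y _ => by
        have h1 := (((hd y).hasDerivAt).pow 2).const_mul (1/2 : ℝ)
        refine h1.congr_deriv ?_
        norm_num
        ring)
      ((hc.continuous.mul hcd).intervalIntegrable _ _)
    rw [h]
    ring
  have key : ∀ M : ℕ, M + 1 ≤ N →
      (∑ j ∈ Finset.Icc 1 (M+1),
        (-(∫ y in (x (j-1))..(x j), v j y * deriv (v j) y)
          + (v j (x j))^2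
          - (if j = 1 then v0 else v (j-1) (x (j-1))) * v j (x (j-1))))
      = (1/2) * (∑ j ∈ Finset.Icc 1 (M+1),
          (v j (x (j-1)) - (if j = 1 then v0 else v (j-1) (x (j-1))))^2)
        + (1/2) * ((v (M+1) (x (M+1)))^2 - v0^2) := by
    intro M
    induction M with
    | zero =>
      intro h
      have h1 := hint 1 (by simp; omega)
      simp only [zero_add, Finset.Icc_self, Finset.sum_singleton, if_true]
      rw [h1]
      ring
    | succ M ih =>
      intro h
      have h1 := hint (M+1+1) (by simp; omega)
      rw [Finset.sum_Icc_succ_top (by omega), ih (by omega),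
        Finset.sum_Icc_succ_top (b := M+1) (by omega), h1, if_neg (by omega)]
      simp only [Nat.add_sub_cancel]
      ring
  obtain ⟨M, rfl⟩ : ∃ M, N = M + 1 := ⟨N - 1, by omega⟩
  have hk := key M le_rfl
  refine ⟨hk, fun h0 => ?_⟩
  rw [hk]
  have hs : 0 ≤ ∑ j ∈ Finset.Icc 1 (M+1),
      (v j (x (j-1)) - (if j = 1 then v0 else v (j-1) (x (j-1))))^2 :=
    Finset.sum_nonneg fun _ _ => sq_nonneg _
  rcases h0 with h0 | h0
  · have := sq_nonneg (v (M+1) (x (M+1)))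
    have h2 : v0^2 = 0 := by rw [h0]; norm_num
    linarith
  · rw [← h0]
    linarith
end

section
/- Let u be continuous on the closure of a cell τ_j. Then the polynomial π(x) = u(x_{j+1/2}) + Σ_{m=1}^{k} u_{j,m} (L_{j,m}(x) − L_{j,m−1}(x)), where u_{j,m} are the Radau coefficients of u on τ_j, satisfies π(x_{j+1/2}) = u(x_{j+1/2}) and ∫_{τ_j} π v dx = ∫_{τ_j} u v dx for every polynomial v of degree ≤ k−1; that is, π = P_h^- u on τ_j. -/
open MeasureTheory intervalIntegral

/-- The truncated Radau expansion of `u` on the cell `(a,b)`. -/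
noncomputable def radauTrunc (k : ℕ) (a b : ℝ) (u : ℝ → ℝ) (y : ℝ) : ℝ :=
  u b + ∑ m ∈ Finset.Icc 1 k,
    radauCoeff a b u m * (legendreCell m a b y - legendreCell (m-1) a b y)

section Helpers
open Polynomial

noncomputable def legPoly (m : ℕ) : ℝ[X] :=
  C (1 / ((2:ℝ) ^ m * (Nat.factorial m : ℝ))) * derivative^[m] ((X ^ 2 - 1) ^ m)

theorem iteratedDeriv_poly (p : ℝ[X]) (m : ℕ) :
    iteratedDeriv m (fun t => p.eval t) = fun t => (derivative^[m] p).eval t := by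
  induction m with
  | zero => simp
  | succ n ih =>
    rw [iteratedDeriv_succ, ih]
    funext t
    rw [Function.iterate_succ_apply']
    exact Polynomial.deriv _

theorem legPoly_eval (m : ℕ) (s : ℝ) : (legPoly m).eval s = legendreP m s := by
  unfold legPoly legendreP
  have := iteratedDeriv_poly ((X ^ 2 - 1) ^ m) m
  simp only [eval_pow, eval_sub, eval_X, eval_one] at this
  rw [this]
  simp

theorem legPoly_natDegree (m : ℕ) : (legPoly m).natDegree ≤ m := by
  unfold legPoly
  refine (natDegree_C_mul_le _ _).trans ((natDegree_iterate_derivative _ _).trans ?_)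
  have h : ((X ^ 2 - 1 : ℝ[X]) ^ m).natDegree ≤ m * 2 := by
    refine natDegree_pow_le_of_le m ?_
    compute_degree
  omega

theorem legPoly_eval_one (m : ℕ) : (legPoly m).eval 1 = 1 := by
  unfold legPoly
  have h := aeval_iterate_derivative_self (A := ℝ) ((X ^ 2 - 1 : ℝ[X]) ^ m) m 1
    (p' := (X + 1) ^ m) (by simp [← mul_pow]; congr 1; ring)
  rw [coe_aeval_eq_eval] at h
  rw [eval_mul, h]
  have : (Nat.factorial m : ℝ) ≠ 0 := by exact_mod_cast Nat.factorial_ne_zero m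
  simp
  norm_num
  field_simp

theorem poly_int (p : ℝ[X]) (a b : ℝ) :
    IntervalIntegrable (fun x => p.eval x) volume a b :=
  p.continuous.intervalIntegrable _ _

theorem W_bdry (m j : ℕ) (hj : j < m) (r : ℝ) (hr : r ^ 2 - 1 = 0) :
    (derivative^[j] ((X ^ 2 - 1 : ℝ[X]) ^ m)).eval r = 0 := by
  have h := pow_sub_dvd_iterate_derivative_of_pow_dvd (p := (X ^ 2 - 1 : ℝ[X]) ^ m)
    (q := X ^ 2 - 1) (n := m) j dvd_rfl
  obtain ⟨c, hc⟩ := h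
  rw [hc, eval_mul, eval_pow]
  simp [hr, Nat.sub_ne_zero_of_lt hj]

theorem W_orth (m j : ℕ) (hj : j ≤ m) : ∀ v : ℝ[X], derivative^[j] v = 0 →
    ∫ s in (-1:ℝ)..1, v.eval s * (derivative^[j] ((X ^ 2 - 1 : ℝ[X]) ^ m)).eval s = 0 := by
  induction j with
  | zero => intro v hv; simp at hv; simp [hv]
  | succ n ih =>
    intro v hv
    rw [Function.iterate_succ_apply']
    rw [intervalIntegral.integral_mul_deriv_eq_deriv_mul
      (u' := fun x => (derivative v).eval x)
      (v := fun x => (derivative^[n] ((X ^ 2 - 1 : ℝ[X]) ^ m)).eval x)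
      (fun x _ => v.hasDerivAt x) (fun x _ => Polynomial.hasDerivAt _ x)
      (poly_int _ _ _) (poly_int _ _ _)]
    rw [ih (by omega) (derivative v) (by rwa [Function.iterate_succ_apply] at hv),
      W_bdry m n (by omega) 1 (by norm_num), W_bdry m n (by omega) (-1) (by norm_num)]
    simp

theorem legPoly_orth (m : ℕ) (v : ℝ[X]) (hv : v.degree < m) :
    ∫ s in (-1:ℝ)..1, v.eval s * (legPoly m).eval s = 0 := by
  have h := W_orth m m le_rfl v (iterate_derivative_eq_zero_of_degree_lt hv)
  unfold legPoly
  simp only [eval_mul, eval_C]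
  simp_rw [mul_left_comm]
  rw [intervalIntegral.integral_const_mul, h, mul_zero]

noncomputable def cellPoly (a b : ℝ) (m : ℕ) : ℝ[X] :=
  (legPoly m).comp (C (2 / (b - a)) * X + C (-(a + b) / (b - a)))

theorem cellPoly_eval (a b : ℝ) (m : ℕ) (x : ℝ) :
    (cellPoly a b m).eval x = legendreCell m a b x := by
  unfold cellPoly legendreCell
  rw [eval_comp, legPoly_eval]
  congr 1
  simp
  ring

theorem affine_natDegree (c d : ℝ) : (C c * X + C d : ℝ[X]).natDegree ≤ 1 := by
  compute_degree

theorem cellPoly_natDegree (a b : ℝ) (m : ℕ) : (cellPoly a b m).natDegree ≤ m := by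
  unfold cellPoly
  refine natDegree_comp_le.trans ?_
  calc _ ≤ m * 1 := Nat.mul_le_mul (legPoly_natDegree m) (affine_natDegree _ _)
    _ = m := mul_one m

theorem cellPoly_eval_b (a b : ℝ) (hab : a < b) (m : ℕ) : (cellPoly a b m).eval b = 1 := by
  unfold cellPoly
  rw [eval_comp]
  have : b - a ≠ 0 := by linarith
  have h : eval b (C (2 / (b - a)) * X + C (-(a + b) / (b - a))) = 1 := by
    simp; field_simp; ring
  rw [h, legPoly_eval_one]

theorem cellPoly_orth (a b : ℝ) (hab : a < b) (m : ℕ) (v : ℝ[X]) (hv : v.degree < m) :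
    ∫ x in a..b, v.eval x * (cellPoly a b m).eval x = 0 := by
  have hne : b - a ≠ 0 := by linarith
  have h := intervalIntegral.smul_integral_comp_mul_add (a := -1) (b := 1)
    (fun x => v.eval x * (cellPoly a b m).eval x) ((b - a) / 2) ((a + b) / 2)
  rw [show (b - a) / 2 * (-1) + (a + b) / 2 = a by ring,
    show (b - a) / 2 * 1 + (a + b) / 2 = b by ring] at h
  rw [← h]
  have h2 := legPoly_orth m (v.comp (C ((b - a) / 2) * X + C ((a + b) / 2))) (by
    by_cases h0 : v = 0
    · simp [h0]
    have hm : v.natDegree < m := (natDegree_lt_iff_degree_lt h0).2 hv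
    refine lt_of_le_of_lt degree_le_natDegree ?_
    have := (natDegree_comp_le (p := v) (q := C ((b - a) / 2) * X + C ((a + b) / 2)))
    have h3 := Nat.mul_le_mul (le_refl v.natDegree)
      (affine_natDegree ((b - a) / 2) ((a + b) / 2))
    exact_mod_cast (by omega : (v.comp (C ((b - a) / 2) * X + C ((a + b) / 2))).natDegree < m))
  have h4 : ∀ s, (cellPoly a b m).eval ((b - a) / 2 * s + (a + b) / 2) = (legPoly m).eval s := by
    intro s
    unfold cellPoly
    rw [eval_comp]
    congr 1
    simp
    field_simp
    ring
  simp only [h4]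
  simp only [eval_comp, eval_add, eval_mul, eval_C, eval_X] at h2
  rw [h2, smul_zero]

theorem cellPoly_norm (a b : ℝ) (hab : a < b) (m : ℕ) :
    (2 * (m:ℝ) + 1) * ∫ x in a..b, (cellPoly a b m).eval x * (cellPoly a b m).eval x = b - a := by
  set Q := cellPoly a b m with hQ
  have hdeg := cellPoly_natDegree a b m
  rw [← hQ] at hdeg
  have hr : ((X - C a) * derivative Q - C (m:ℝ) * Q).degree < (m : WithBot ℕ) := by
    rw [degree_lt_iff_coeff_zero]
    intro n hn
    rw [coeff_sub, coeff_C_mul, sub_mul, coeff_sub, coeff_C_mul, coeff_derivative]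
    have h1 : Q.coeff (n+1) = 0 := coeff_eq_zero_of_natDegree_lt (by omega)
    have h2 : (X * derivative Q).coeff n = n * Q.coeff n := by
      cases n with
      | zero => simp
      | succ k => rw [coeff_X_mul, coeff_derivative]; push_cast; ring
    rw [h1, h2]
    rcases hn.eq_or_lt with h | h
    · subst h; ring
    · rw [coeff_eq_zero_of_natDegree_lt (by omega : Q.natDegree < n)]; ring
  have ho := cellPoly_orth a b hab m _ hr
  rw [← hQ] at ho
  have hF := intervalIntegral.integral_eq_sub_of_hasDerivAt (a := a) (b := b)
    (f := fun x => ((X - C a) * Q * Q).eval x)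
    (fun x _ => Polynomial.hasDerivAt _ x) (poly_int _ _ _)
  have hE : ∀ x, (derivative ((X - C a) * Q * Q)).eval x =
      (2 * (m:ℝ) + 1) * (Q.eval x * Q.eval x) +
      2 * (((X - C a) * derivative Q - C (m:ℝ) * Q).eval x * Q.eval x) := by
    intro x
    simp
    ring
  simp only [hE] at hF
  rw [intervalIntegral.integral_add, intervalIntegral.integral_const_mul,
    intervalIntegral.integral_const_mul, ho] at hF
  · have hb := cellPoly_eval_b a b hab m
    rw [← hQ] at hb
    simp [hb] at hF
    exact hF
  · exact Continuous.intervalIntegrable (by fun_prop) _ _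
  · exact Continuous.intervalIntegrable (by fun_prop) _ _

theorem cellPoly_coeff_ne (a b : ℝ) (hab : a < b) (m : ℕ) : (cellPoly a b m).coeff m ≠ 0 := by
  intro h
  have hd : (cellPoly a b m).degree < m := by
    rw [degree_lt_iff_coeff_zero]
    intro n hn
    rcases hn.eq_or_lt with h' | h'
    · rw [← h', h]
    · exact coeff_eq_zero_of_natDegree_lt (lt_of_le_of_lt (cellPoly_natDegree a b m) h')
  have := cellPoly_norm a b hab m
  rw [cellPoly_orth a b hab m _ hd] at this
  linarith

theorem cellPoly_ortho_ne (a b : ℝ) (hab : a < b) (m n : ℕ) (hmn : m ≠ n) :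
    ∫ x in a..b, (cellPoly a b m).eval x * (cellPoly a b n).eval x = 0 := by
  have key : ∀ i j : ℕ, i < j → (cellPoly a b i).degree < j := fun i j h =>
    lt_of_le_of_lt degree_le_natDegree
      (by exact_mod_cast lt_of_le_of_lt (cellPoly_natDegree a b i) h)
  rcases lt_or_gt_of_ne hmn with h | h
  · exact cellPoly_orth a b hab n _ (key _ _ h)
  · simp_rw [mul_comm (eval _ (cellPoly a b m))]
    exact cellPoly_orth a b hab m _ (key _ _ h)

noncomputable def radauPoly (k : ℕ) (a b : ℝ) (u : ℝ → ℝ) : ℝ[X] :=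
  C (u b) + ∑ m ∈ Finset.Icc 1 k,
    C (radauCoeff a b u m) * (cellPoly a b m - cellPoly a b (m-1))

theorem radauPoly_eval (k : ℕ) (a b : ℝ) (u : ℝ → ℝ) (y : ℝ) :
    (radauPoly k a b u).eval y = radauTrunc k a b u y := by
  unfold radauPoly radauTrunc
  simp [eval_finsetSum, cellPoly_eval]

theorem u_int (a b : ℝ) (hab : a < b) (u : ℝ → ℝ) (hu : ContinuousOn u (Set.Icc a b))
    (v : ℝ[X]) : IntervalIntegrable (fun x => u x * v.eval x) volume a b := by
  apply ContinuousOn.intervalIntegrable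
  rw [Set.uIcc_of_le hab.le]
  exact hu.mul v.continuous.continuousOn

theorem radauCoeff_zero (a b : ℝ) (u : ℝ → ℝ) : radauCoeff a b u 0 = u b := by
  simp [radauCoeff]

theorem radauCoeff_succ (a b : ℝ) (hab : a < b) (u : ℝ → ℝ) (hu : ContinuousOn u (Set.Icc a b))
    (m : ℕ) : radauCoeff a b u (m+1) = radauCoeff a b u m
      - (2 * (m:ℝ) + 1) / (b - a) * ∫ x in a..b, u x * (cellPoly a b m).eval x := by
  unfold radauCoeff
  simp only [← cellPoly_eval]
  have h : ∀ n : ℕ, ∀ x, ∑ l ∈ Finset.range n, (2 * (l:ℝ) + 1) * (cellPoly a b l).eval x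
      = (∑ l ∈ Finset.range n, C (2 * (l:ℝ) + 1) * cellPoly a b l).eval x := by
    intro n x
    rw [eval_finsetSum]
    simp
  have e : ∀ x, u x * ∑ l ∈ Finset.range (m+1), (2 * (l:ℝ) + 1) * (cellPoly a b l).eval x
      = u x * (∑ l ∈ Finset.range m, C (2 * (l:ℝ) + 1) * cellPoly a b l).eval x
        + (2 * (m:ℝ) + 1) * (u x * (cellPoly a b m).eval x) := by
    intro x
    rw [Finset.sum_range_succ, h]
    ring
  simp only [e]
  rw [intervalIntegral.integral_add (u_int a b hab u hu _) ((u_int a b hab u hu _).const_mul _),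
    intervalIntegral.integral_const_mul]
  simp only [h]
  ring

theorem radauPoly_eq (k : ℕ) (a b : ℝ) (hab : a < b) (u : ℝ → ℝ)
    (hu : ContinuousOn u (Set.Icc a b)) :
    radauPoly k a b u = ∑ l ∈ Finset.range k, C ((2 * (l:ℝ) + 1) / (b - a) *
      ∫ x in a..b, u x * (cellPoly a b l).eval x) * cellPoly a b l
      + C (radauCoeff a b u k) * cellPoly a b k := by
  induction k with
  | zero =>
    have : cellPoly a b 0 = 1 := by
      unfold cellPoly legPoly; simp
    simp [radauPoly, radauCoeff_zero, this]
  | succ n ih =>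
    have h : radauPoly (n+1) a b u = radauPoly n a b u
        + C (radauCoeff a b u (n+1)) * (cellPoly a b (n+1) - cellPoly a b n) := by
      unfold radauPoly
      rw [Finset.sum_Icc_succ_top (by omega)]
      simp [add_assoc]
    rw [h, ih, Finset.sum_range_succ, radauCoeff_succ a b hab u hu n, C_sub]
    ring

theorem radauPoly_natDegree (k : ℕ) (a b : ℝ) (u : ℝ → ℝ) :
    (radauPoly k a b u).natDegree ≤ k := by
  unfold radauPoly
  refine natDegree_add_le_of_degree_le (by simp) (natDegree_sum_le_of_forall_le _ _ ?_)
  intro i hi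
  rw [Finset.mem_Icc] at hi
  refine (natDegree_C_mul_le _ _).trans ((natDegree_sub_le _ _).trans (max_le
    ((cellPoly_natDegree a b i).trans hi.2) ((cellPoly_natDegree a b (i-1)).trans ?_)))
  omega

theorem radauPoly_Q (k : ℕ) (a b : ℝ) (hab : a < b) (u : ℝ → ℝ)
    (hu : ContinuousOn u (Set.Icc a b)) (n : ℕ) (hn : n < k) :
    ∫ x in a..b, (radauPoly k a b u).eval x * (cellPoly a b n).eval x
      = ∫ x in a..b, u x * (cellPoly a b n).eval x := by
  rw [radauPoly_eq k a b hab u hu]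
  simp only [eval_add, eval_finsetSum, eval_mul, eval_C, add_mul, Finset.sum_mul, mul_assoc]
  rw [intervalIntegral.integral_add, intervalIntegral.integral_finsetSum]
  · simp only [intervalIntegral.integral_const_mul]
    rw [cellPoly_ortho_ne a b hab k n (by omega), Finset.sum_eq_single n]
    · have h := cellPoly_norm a b hab n
      have hne : b - a ≠ 0 := by linarith
      rw [mul_zero, add_zero]
      generalize (∫ x in a..b, (cellPoly a b n).eval x * (cellPoly a b n).eval x) = I at h ⊢
      generalize (∫ x in a..b, u x * (cellPoly a b n).eval x) = J
      field_simp
      linear_combination J * h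
    · intro i _ hi
      rw [cellPoly_ortho_ne a b hab i n hi]; simp
    · intro h; simp at h; omega
  · intro i _
    exact Continuous.intervalIntegrable (by fun_prop) _ _
  · exact Continuous.intervalIntegrable (by fun_prop) _ _
  · exact Continuous.intervalIntegrable (by fun_prop) _ _

theorem radauPoly_orth (k : ℕ) (a b : ℝ) (hab : a < b) (u : ℝ → ℝ)
    (hu : ContinuousOn u (Set.Icc a b)) (n : ℕ) (hn : n ≤ k) : ∀ v : ℝ[X], v.degree < n →
    ∫ x in a..b, (radauPoly k a b u).eval x * v.eval x = ∫ x in a..b, u x * v.eval x := by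
  induction n with
  | zero =>
    intro v hv
    have : v = 0 := by
      rw [← degree_eq_bot]; exact Nat.WithBot.lt_zero_iff.1 (by simpa using hv)
    simp [this]
  | succ n ih =>
    intro v hv
    have hq := cellPoly_coeff_ne a b hab n
    set c := v.coeff n / (cellPoly a b n).coeff n with hc
    have hr : (v - C c * cellPoly a b n).degree < n := by
      rw [degree_lt_iff_coeff_zero] at hv ⊢
      intro i hi
      rw [coeff_sub, coeff_C_mul]
      rcases hi.eq_or_lt with h | h
      · subst h; rw [hc]; field_simp; ring
      · rw [hv i h, coeff_eq_zero_of_natDegree_lt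
          (lt_of_le_of_lt (cellPoly_natDegree a b n) h)]
        ring
    have h1 := ih (by omega) _ hr
    have h2 := radauPoly_Q k a b hab u hu n (by omega)
    have hsplit : ∀ w : ℝ → ℝ, ContinuousOn w (Set.Icc a b) →
        ∫ x in a..b, w x * v.eval x = (∫ x in a..b, w x * (v - C c * cellPoly a b n).eval x)
          + c * ∫ x in a..b, w x * (cellPoly a b n).eval x := by
      intro w hw
      rw [← intervalIntegral.integral_const_mul, ← intervalIntegral.integral_add
        (u_int a b hab w hw _) ((u_int a b hab w hw _).const_mul _)]
      congr 1
      funext x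
      simp
      ring
    rw [hsplit _ hu, hsplit _ (radauPoly k a b u).continuous.continuousOn, h1, h2]

theorem gr_unique (k : ℕ) (hk : 1 ≤ k) (a b : ℝ) (hab : a < b) (R : ℝ[X])
    (hd : R.natDegree ≤ k) (hb : R.eval b = 0)
    (ho : ∀ v : ℝ[X], v.natDegree + 1 ≤ k → ∫ x in a..b, R.eval x * v.eval x = 0) :
    ∀ y ∈ Set.Icc a b, R.eval y = 0 := by
  obtain ⟨S, hS⟩ := dvd_iff_isRoot.2 hb
  have hSd : S.natDegree + 1 ≤ k := by
    by_cases h0 : S = 0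
    · simpa [h0] using hk
    · rw [hS, natDegree_mul (X_sub_C_ne_zero b) h0, natDegree_X_sub_C] at hd
      omega
  have h := ho S hSd
  by_contra! hcon
  obtain ⟨y, hy, hne⟩ := hcon
  have hpos : 0 < ∫ x in a..b, -(R.eval x * S.eval x) := by
    refine intervalIntegral.integral_pos hab (by fun_prop) ?_ ⟨y, hy, ?_⟩
    · intro x hx
      rw [hS]; simp
      nlinarith [hx.2, mul_nonneg (sub_nonneg.2 hx.2) (mul_self_nonneg (S.eval x))]
    · rw [hS] at hne ⊢
      simp at hne ⊢
      have h1 : 0 < b - y := lt_of_le_of_ne (sub_nonneg.2 hy.2) (by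
        intro h; exact hne.1 (by linarith))
      have h2 : 0 < S.eval y * S.eval y := mul_self_pos.2 hne.2
      nlinarith [mul_pos h1 h2]
  rw [intervalIntegral.integral_neg, h] at hpos
  simp at hpos

end Helpers

/-- the truncated Radau expansion is the Gauss–Radau projection. -/
theorem stmt3 (k : ℕ) (hk : 1 ≤ k) (a b : ℝ) (hab : a < b)
    (u : ℝ → ℝ) (hu : ContinuousOn u (Set.Icc a b)) :
    (radauTrunc k a b u b = u b)
    ∧ (∀ v : Polynomial ℝ, v.natDegree + 1 ≤ k →
        (∫ y in a..b, radauTrunc k a b u y * v.eval y) = ∫ y in a..b, u y * v.eval y)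
    ∧ (∀ P : Polynomial ℝ, IsGRProj k a b u P →
        ∀ y ∈ Set.Icc a b, P.eval y = radauTrunc k a b u y) := by
  classical
  have hbb : radauTrunc k a b u b = u b := by
    unfold radauTrunc
    simp [← cellPoly_eval, cellPoly_eval_b a b hab]
  have horth : ∀ v : Polynomial ℝ, v.natDegree + 1 ≤ k →
      (∫ y in a..b, radauTrunc k a b u y * v.eval y) = ∫ y in a..b, u y * v.eval y := by
    intro v hv
    simp only [← radauPoly_eval]
    refine radauPoly_orth k a b hab u hu k le_rfl v ?_
    exact lt_of_le_of_lt Polynomial.degree_le_natDegree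
      (by exact_mod_cast (by omega : v.natDegree < k))
  refine ⟨hbb, horth, ?_⟩
  rintro P ⟨hd, ho, hPb⟩ y hy
  have h := gr_unique k hk a b hab (P - radauPoly k a b u)
    (Polynomial.natDegree_sub_le_of_le hd (radauPoly_natDegree k a b u) |>.trans (by simp))
    (by rw [Polynomial.eval_sub, radauPoly_eval, hbb, hPb, sub_self])
    (by
      intro v hv
      have h1 := horth v hv
      simp only [← radauPoly_eval] at h1
      simp only [Polynomial.eval_sub, sub_mul]
      rw [intervalIntegral.integral_sub (Continuous.intervalIntegrable (by fun_prop) _ _)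
        (Continuous.intervalIntegrable (by fun_prop) _ _), ho v hv, h1, sub_self])
    y hy
  rw [Polynomial.eval_sub, radauPoly_eval] at h
  linarith
end

section
/- Let w be continuous on the closure of a cell τ_j. Then for every polynomial v of degree ≤ k, ∫_{τ_j} (w − P_h^- w) v dx = − w_{j,k+1} ∫_{τ_j} L_{j,k} v dx, where w_{j,k+1} is the (k+1)st Radau coefficient of w on τ_j. -/
open MeasureTheory intervalIntegral

open Polynomial in
/-- The cell Legendre polynomial. -/
noncomputable def QQ (a b : ℝ) (m : ℕ) : Polynomial ℝ :=
  C (1 / ((m.factorial : ℝ) * (b - a) ^ m)) * derivative^[m] (((X - C a) * (X - C b)) ^ m)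

open Polynomial in
lemma iter_comp (p : Polynomial ℝ) (α β : ℝ) (m : ℕ) :
    derivative^[m] (p.comp (C α * X + C β)) = C (α ^ m) * (derivative^[m] p).comp (C α * X + C β) := by
  induction m with
  | zero => simp
  | succ n ih =>
    rw [Function.iterate_succ_apply', ih, Function.iterate_succ_apply', derivative_C_mul,
      derivative_comp]
    simp [pow_succ]
    ring

open Polynomial in
lemma iterD_eval (p : Polynomial ℝ) (m : ℕ) :
    iteratedDeriv m (fun t => p.eval t) = fun t => (derivative^[m] p).eval t := by
  induction m with
  | zero => simp
  | succ n ih =>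
    rw [iteratedDeriv_succ, ih, Function.iterate_succ_apply']
    ext t
    simp

open Polynomial in
lemma cell_eq (a b : ℝ) (hab : a < b) (m : ℕ) (x : ℝ) :
    legendreCell m a b x = (QQ a b m).eval x := by
  have hne : b - a ≠ 0 := by linarith
  have h1 : (fun t : ℝ => (t ^ 2 - 1) ^ m) = fun t => (((X : Polynomial ℝ) ^ 2 - 1) ^ m).eval t := by
    ext t; simp
  unfold legendreCell legendreP QQ
  rw [h1, iterD_eval]
  beta_reduce
  have h2 : (((X : Polynomial ℝ) ^ 2 - 1) ^ m).comp (C (2 / (b - a)) * X + C (-(a + b) / (b - a)))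
      = C ((4 / (b - a) ^ 2) ^ m) * ((X - C a) * (X - C b)) ^ m := by
    refine Polynomial.funext fun y => ?_
    simp only [eval_comp, eval_pow, eval_sub, eval_X, eval_one, eval_add, eval_mul, eval_C]
    rw [← mul_pow]
    congr 1
    field_simp
    ring
  have h3 := iter_comp (((X : Polynomial ℝ) ^ 2 - 1) ^ m) (2 / (b - a)) (-(a + b) / (b - a)) m
  rw [h2, iterate_derivative_C_mul] at h3
  have h4 := congrArg (fun p => eval x p) h3
  simp only [eval_comp, eval_mul, eval_C, eval_add, eval_X] at h4
  have h5 : 2 / (b - a) * x + -(a + b) / (b - a) = (2 * x - (a + b)) / (b - a) := by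
    field_simp; ring
  rw [h5] at h4
  rw [eval_mul, eval_C]
  have hf : (m.factorial : ℝ) ≠ 0 := by positivity
  generalize eval ((2 * x - (a + b)) / (b - a)) (derivative^[m] (((X : Polynomial ℝ) ^ 2 - 1) ^ m)) = A at *
  generalize eval x (derivative^[m] (((X - C a) * (X - C b)) ^ m)) = B at *
  have e4 : (4 : ℝ) ^ m = 2 ^ m * 2 ^ m := by rw [← mul_pow]; norm_num
  have e5 : ((b - a) ^ 2) ^ m = (b - a) ^ m * (b - a) ^ m := by rw [← mul_pow]; ring
  rw [div_pow, div_pow, e4, e5] at h4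
  field_simp at h4 ⊢
  linarith

open Polynomial in
lemma QQ_b (a b : ℝ) (hab : a < b) (m : ℕ) : (QQ a b m).eval b = 1 := by
  have hne : b - a ≠ 0 := by linarith
  have := aeval_iterate_derivative_self (((X - C a) * (X - C b)) ^ m) m b
    (p' := (X - C a) ^ m) (by simp [mul_pow, mul_comm])
  simp only [coe_aeval_eq_eval] at this
  rw [QQ, eval_mul, this]
  have hf : (m.factorial : ℝ) ≠ 0 := by positivity
  simp
  field_simp

open Polynomial in
lemma QQ_deg (a b : ℝ) (m : ℕ) : (QQ a b m).natDegree ≤ m := by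
  refine (natDegree_C_mul_le _ _).trans ((natDegree_iterate_derivative _ _).trans ?_)
  rw [natDegree_pow, natDegree_mul (X_sub_C_ne_zero a) (X_sub_C_ne_zero b)]
  simp
  lia

open Polynomial in
lemma QQ_coeff (a b : ℝ) (hab : a < b) (m : ℕ) : (QQ a b m).coeff m ≠ 0 := by
  have hne : b - a ≠ 0 := by linarith
  have hM : (((X - C a) * (X - C b)) ^ m).Monic :=
    ((monic_X_sub_C a).mul (monic_X_sub_C b)).pow m
  have hd : (((X - C a) * (X - C b)) ^ m).natDegree = m + m := by
    rw [natDegree_pow, natDegree_mul (X_sub_C_ne_zero a) (X_sub_C_ne_zero b)]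
    simp
    lia
  have hc : (((X - C a) * (X - C b)) ^ m).coeff (m + m) = 1 := by
    rw [← hd]; exact hM
  rw [QQ, coeff_C_mul, coeff_iterate_derivative, hc]
  have hf : (m.factorial : ℝ) ≠ 0 := by positivity
  have : ((m + m).descFactorial m : ℝ) ≠ 0 := by
    have := Nat.descFactorial_eq_zero_iff_lt (n := m + m) (k := m)
    exact_mod_cast fun h => absurd (this.1 h) (by lia)
  rw [nsmul_eq_mul, mul_one]
  exact mul_ne_zero (one_div_ne_zero (mul_ne_zero hf (pow_ne_zero _ hne))) this

lemma ii (p : Polynomial ℝ) (a b : ℝ) : IntervalIntegrable (fun x => p.eval x) volume a b :=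
  p.continuous.intervalIntegrable _ _

open Polynomial in
lemma parts (p q : Polynomial ℝ) (a b : ℝ) :
    ∫ x in a..b, (derivative p).eval x * q.eval x
      = p.eval b * q.eval b - p.eval a * q.eval a - ∫ x in a..b, p.eval x * (derivative q).eval x := by
  have h := integral_mul_deriv_eq_deriv_mul (a := a) (b := b) (fun x _ => p.hasDerivAt x)
    (fun x _ => q.hasDerivAt x) (ii _ _ _) (ii _ _ _)
  linarith

open Polynomial in
lemma orth_aux (a b : ℝ) (m j : ℕ) (hj : j ≤ m) : ∀ v : Polynomial ℝ, v.natDegree < j →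
    ∫ x in a..b, (derivative^[j] (((X - C a) * (X - C b)) ^ m)).eval x * v.eval x = 0 := by
  induction j with
  | zero => intro v hv; lia
  | succ n ih =>
    intro v hv
    have hb := aeval_iterate_derivative_of_lt (((X - C a) * (X - C b)) ^ m) m b
      (p' := (X - C a) ^ m) (by simp [mul_pow, mul_comm]) (k := n) (by lia)
    have ha := aeval_iterate_derivative_of_lt (((X - C a) * (X - C b)) ^ m) m a
      (p' := (X - C b) ^ m) (by simp [mul_pow]) (k := n) (by lia)
    simp only [coe_aeval_eq_eval] at ha hb
    rw [Function.iterate_succ_apply', parts, ha, hb]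
    by_cases h0 : v.natDegree = 0
    · rw [derivative_of_natDegree_zero h0]; simp
    · rw [ih (by lia) _ ((natDegree_derivative_lt h0).trans_le (by lia))]; simp

open Polynomial in
lemma orth (a b : ℝ) (m : ℕ) (v : Polynomial ℝ) (hv : v.natDegree < m) :
    ∫ x in a..b, (QQ a b m).eval x * v.eval x = 0 := by
  unfold QQ
  simp only [eval_mul, eval_C, mul_assoc]
  rw [intervalIntegral.integral_const_mul, orth_aux a b m m le_rfl v hv, mul_zero]

open Polynomial in
lemma lower {p : Polynomial ℝ} {m : ℕ} (h : p.natDegree ≤ m) (hc : p.coeff m = 0) :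
    p = 0 ∨ p.natDegree < m := by
  rcases h.lt_or_eq with h | h
  · exact Or.inr h
  · left
    rw [← h] at hc
    exact leadingCoeff_eq_zero.1 hc

lemma orth' (a b : ℝ) (m : ℕ) (v : Polynomial ℝ) (hv : v.natDegree ≤ m) (hc : v.coeff m = 0) :
    ∫ x in a..b, (QQ a b m).eval x * v.eval x = 0 := by
  rcases lower hv hc with h | h
  · simp [h]
  · exact orth a b m v h

open Polynomial in
lemma sq_int (a b : ℝ) (hab : a < b) (m : ℕ) :
    (2 * (m : ℝ) + 1) * ∫ x in a..b, (QQ a b m).eval x * (QQ a b m).eval x = b - a := by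
  set Q := QQ a b m with hQ
  have h1 := parts (Q * Q) (X - C a) a b
  have hQb : Q.eval b = 1 := QQ_b a b hab m
  have hD : Q.derivative.natDegree ≤ m - 1 :=
    (natDegree_derivative_le _).trans (Nat.sub_le_sub_right (QQ_deg a b m) 1)
  have h2 := orth' a b m ((X - C a) * Q.derivative - C (m : ℝ) * Q) (by
      rcases Nat.eq_zero_or_pos m with h0 | h0
      · have : Q.natDegree = 0 := by have := QQ_deg a b m; lia
        rw [derivative_of_natDegree_zero this]
        simp [h0]
      refine (natDegree_sub_le _ _).trans (max_le ?_ ((natDegree_C_mul_le _ _).trans (QQ_deg a b m)))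
      refine natDegree_mul_le.trans ?_
      rw [natDegree_X_sub_C]; lia) (by
      have hz : Q.coeff (m + 1) = 0 :=
        coeff_eq_zero_of_natDegree_lt (by have := QQ_deg a b m; lia)
      rw [coeff_sub, sub_mul, coeff_sub, coeff_C_mul, coeff_C_mul, coeff_derivative, hz]
      cases m with
      | zero => simp
      | succ n => rw [coeff_X_mul, coeff_derivative]; push_cast; ring)
  rw [← hQ] at h2
  simp only [derivative_mul, derivative_sub, derivative_X, derivative_C, eval_mul, eval_add,
    eval_sub, eval_X, eval_C, hQb, sub_self, sub_zero, eval_one, mul_one, mul_zero, one_mul] at h1 h2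
  have e1 : ∀ x : ℝ, (eval x (derivative Q) * eval x Q + eval x Q * eval x (derivative Q)) * (x - a)
     = 2 * (eval x Q * ((x - a) * eval x (derivative Q) - m * eval x Q)) + (2 * m) * (eval x Q * eval x Q) := by
    intro x; ring
  simp only [e1] at h1
  rw [intervalIntegral.integral_add, intervalIntegral.integral_const_mul,
    intervalIntegral.integral_const_mul, h2] at h1
  · linarith
  · exact Continuous.intervalIntegrable (by fun_prop) _ _
  · exact Continuous.intervalIntegrable (by fun_prop) _ _

open Polynomial in
lemma decomp (a b : ℝ) (hab : a < b) (m : ℕ) (v : Polynomial ℝ) (hv : v.natDegree ≤ m) :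
    ∃ (c : ℝ) (r : Polynomial ℝ), v = C c * QQ a b m + r ∧ (r = 0 ∨ r.natDegree < m) := by
  refine ⟨v.coeff m / (QQ a b m).coeff m, v - C (v.coeff m / (QQ a b m).coeff m) * QQ a b m,
    by ring, lower ?_ ?_⟩
  · exact (natDegree_sub_le _ _).trans (max_le hv ((natDegree_C_mul_le _ _).trans (QQ_deg a b m)))
  · rw [coeff_sub, coeff_C_mul, div_mul_cancel₀ _ (QQ_coeff a b hab m), sub_self]

open Polynomial in
/-- The reproducing kernel at the right endpoint. -/
noncomputable def KK (a b : ℝ) (m : ℕ) : Polynomial ℝ :=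
  ∑ l ∈ Finset.range m, C (2 * (l : ℝ) + 1) * QQ a b l

open Polynomial in
lemma KK_deg (a b : ℝ) (m : ℕ) : (KK a b m).natDegree ≤ m - 1 := by
  refine natDegree_sum_le_of_forall_le _ _ fun l hl => ?_
  have := Finset.mem_range.1 hl
  exact (natDegree_C_mul_le _ _).trans ((QQ_deg a b l).trans (by lia))

open Polynomial in
lemma KK_succ (a b : ℝ) (m : ℕ) (x : ℝ) : (KK a b (m + 1)).eval x =
    (KK a b m).eval x + (2 * (m : ℝ) + 1) * (QQ a b m).eval x := by
  rw [KK, Finset.sum_range_succ, ← KK]; simp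

lemma intlin (f g : ℝ → ℝ) (a b c d : ℝ) (hf : IntervalIntegrable f volume a b)
    (hg : IntervalIntegrable g volume a b) :
    ∫ x in a..b, (c * f x + d * g x) = c * (∫ x in a..b, f x) + d * ∫ x in a..b, g x := by
  rw [intervalIntegral.integral_add (hf.const_mul c) (hg.const_mul d),
    intervalIntegral.integral_const_mul, intervalIntegral.integral_const_mul]

open Polynomial in
lemma reprod (a b : ℝ) (hab : a < b) (m : ℕ) : ∀ p : Polynomial ℝ, (p = 0 ∨ p.natDegree < m) →
    ∫ x in a..b, p.eval x * (KK a b m).eval x = (b - a) * p.eval b := by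
  induction m with
  | zero => intro p hp; rcases hp with h | h; · simp [h]
            · lia
  | succ n ih =>
    intro p hp
    have hp' : p.natDegree ≤ n := by
      rcases hp with h | h
      · simp [h]
      · lia
    obtain ⟨c, r, rfl, hr⟩ := decomp a b hab n p hp'
    have h1 := ih r hr
    have h2 : ∫ x in a..b, (QQ a b n).eval x * r.eval x = 0 := by
      rcases hr with h | h
      · simp [h]
      · exact orth a b n r h
    have h3 : ∫ x in a..b, (QQ a b n).eval x * (KK a b n).eval x = 0 := by
      rcases Nat.eq_zero_or_pos n with h | h
      · subst h; simp [KK]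
      · exact orth a b n _ (by have := KK_deg a b n; lia)
    have h4 := sq_int a b hab n
    have e : ∀ x : ℝ, (C c * QQ a b n + r).eval x * (KK a b (n + 1)).eval x =
      1 * (1 * (r.eval x * (KK a b n).eval x) + c * ((QQ a b n).eval x * (KK a b n).eval x)) +
      (2 * (n : ℝ) + 1) * (c * ((QQ a b n).eval x * (QQ a b n).eval x) + 1 * ((QQ a b n).eval x * r.eval x)) := by
      intro x; rw [KK_succ]; simp; ring
    simp only [e]
    rw [intlin, intlin, intlin, h1, h2, h3, eval_add, eval_mul, eval_C, QQ_b a b hab]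
    · linear_combination c * h4
    all_goals exact Continuous.intervalIntegrable (by fun_prop) _ _

/-- `∫ (w - P_h^- w) v = - w_{j,k+1} ∫ L_{j,k} v` for all `v` of degree ≤ k. -/
theorem stmt4 (k : ℕ) (hk : 1 ≤ k) (a b : ℝ) (hab : a < b)
    (w : ℝ → ℝ) (hw : ContinuousOn w (Set.Icc a b))
    (P : Polynomial ℝ) (hP : IsGRProj k a b w P)
    (v : Polynomial ℝ) (hv : v.natDegree ≤ k) :
    (∫ y in a..b, (w y - P.eval y) * v.eval y)
      = - radauCoeff a b w (k+1) * ∫ y in a..b, legendreCell k a b y * v.eval y := by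
  obtain ⟨hPd, hPo, hPb⟩ := hP
  have hne : b - a ≠ 0 := by linarith
  have hwi : ∀ q : Polynomial ℝ, IntervalIntegrable (fun x => w x * q.eval x) volume a b := by
    intro q
    refine ContinuousOn.intervalIntegrable ?_
    rw [Set.uIcc_of_le hab.le]
    exact hw.mul q.continuous.continuousOn
  have hpi : ∀ q : Polynomial ℝ, IntervalIntegrable (fun x => P.eval x * q.eval x) volume a b :=
    fun q => Continuous.intervalIntegrable (by fun_prop) _ _
  -- the error functional
  have hE : ∀ q : Polynomial ℝ, ∫ y in a..b, (w y - P.eval y) * q.eval y =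
      (∫ y in a..b, w y * q.eval y) - ∫ y in a..b, P.eval y * q.eval y := by
    intro q
    rw [← intervalIntegral.integral_sub (hwi q) (hpi q)]
    simp only [sub_mul]
  have hR : radauCoeff a b w (k + 1) = w b - (1 / (b - a)) *
      ∫ x in a..b, w x * (KK a b (k + 1)).eval x := by
    simp only [radauCoeff, KK, Polynomial.eval_finsetSum, Polynomial.eval_mul, Polynomial.eval_C, cell_eq a b hab]
  have hK := reprod a b hab (k + 1) P (Or.inr (by lia))
  simp only [KK_succ, mul_add] at hK hR
  have hs : ∀ f : ℝ → ℝ, (∀ q : Polynomial ℝ, IntervalIntegrable (fun x => f x * q.eval x) volume a b) →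
      ∫ x in a..b, (f x * (KK a b k).eval x + f x * ((2 * (k : ℝ) + 1) * (QQ a b k).eval x)) =
      (∫ x in a..b, f x * (KK a b k).eval x) + (2 * (k : ℝ) + 1) * ∫ x in a..b, f x * (QQ a b k).eval x := by
    intro f hf
    have := intlin _ _ a b 1 (2 * (k : ℝ) + 1) (hf (KK a b k)) (hf (QQ a b k))
    rw [one_mul] at this
    rw [← this]
    congr 1
    ext x
    ring
  rw [hs _ hpi] at hK
  rw [hs _ hwi] at hR
  have hKo := hPo (KK a b k) (by have := KK_deg a b k; lia)
  obtain ⟨c, r, rfl, hr⟩ := decomp a b hab k v hv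
  have hro : ∫ x in a..b, P.eval x * r.eval x = ∫ x in a..b, w x * r.eval x := by
    rcases hr with h | h
    · simp [h]
    · exact hPo r (by lia)
  have hrQ : ∫ x in a..b, (QQ a b k).eval x * r.eval x = 0 := by
    rcases hr with h | h
    · simp [h]
    · exact orth a b k r h
  have hsq := sq_int a b hab k
  have hlin : ∀ f : ℝ → ℝ, (∀ q : Polynomial ℝ, IntervalIntegrable (fun x => f x * q.eval x) volume a b) →
      ∫ x in a..b, f x * (Polynomial.C c * QQ a b k + r).eval x =
      c * (∫ x in a..b, f x * (QQ a b k).eval x) + ∫ x in a..b, f x * r.eval x := by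
    intro f hf
    have := intlin _ _ a b c 1 (hf (QQ a b k)) (hf r)
    rw [one_mul] at this
    rw [← this]
    congr 1
    ext x
    simp
    ring
  simp only [cell_eq a b hab]
  rw [hE, hlin _ hwi, hlin _ hpi,
    hlin _ (fun q => Continuous.intervalIntegrable (by fun_prop) _ _), hrQ, hro, hR]
  rw [hKo] at hK
  rw [hPb] at hK
  set S := ∫ x in a..b, (QQ a b k).eval x * (QQ a b k).eval x
  set IW := ∫ x in a..b, w x * (QQ a b k).eval x
  set IP := ∫ x in a..b, P.eval x * (QQ a b k).eval x
  set IK := ∫ x in a..b, w x * (KK a b k).eval x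
  have hwb : w b = (1 / (b - a)) * (IK + (2 * (k : ℝ) + 1) * IP) := by
    rw [hK]; field_simp
  rw [hwb, ← hsq]
  have h2 : (2 * (k : ℝ) + 1) * S ≠ 0 := by rw [hsq]; exact hne
  have h3 : S ≠ 0 := right_ne_zero_of_mul h2
  have h4 : (2 * (k : ℝ) + 1) ≠ 0 := left_ne_zero_of_mul h2
  field_simp
  ring
end

section
/- For every cell τ_j, every 1 ≤ i ≤ k, and every polynomial v of degree ≤ k−i−1, ∫_{τ_j} F_i(x) v(x) dx = 0. -/
open MeasureTheory intervalIntegral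

lemma aux_antideriv (v : Polynomial ℝ) :
    ∃ V : Polynomial ℝ, V.derivative = v ∧ V.natDegree ≤ v.natDegree + 1 := by
  refine ⟨∑ i ∈ Finset.range (v.natDegree + 1),
    Polynomial.monomial (i + 1) (v.coeff i / ((i : ℝ) + 1)), ?_, ?_⟩
  · conv_rhs => rw [v.as_sum_range]
    rw [Polynomial.derivative_sum]
    refine Finset.sum_congr rfl fun i _ => ?_
    rw [Polynomial.derivative_monomial]
    have h : ((i : ℝ) + 1) ≠ 0 := by positivity
    simp only [Nat.add_sub_cancel]
    push_cast
    rw [div_mul_cancel₀ _ h]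
  · refine Polynomial.natDegree_sum_le_of_forall_le _ _ fun i hi => ?_
    have := Finset.mem_range.1 hi
    exact (Polynomial.natDegree_monomial_le _).trans (by omega)

/-- Orthogonality to polynomials of degree `< m`. -/
def auxOrth (a b : ℝ) (f : ℝ → ℝ) (m : ℕ) : Prop :=
  ∀ w : Polynomial ℝ, w.natDegree + 1 ≤ m → (∫ x in a..b, f x * w.eval x) = 0

lemma aux_Dinv (a b : ℝ) (f : ℝ → ℝ) (hf : Continuous f) (m : ℕ)
    (h : auxOrth a b f (m + 1)) : auxOrth a b (Dinv a b f) m := by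
  intro w hw
  obtain ⟨V, hV, hd⟩ := aux_antideriv w
  have h1 : (∫ x in a..b, f x) = 0 := by
    have := h 1 (by simp)
    simpa using this
  have h2 := h V (by omega)
  have key := intervalIntegral.integral_mul_deriv_eq_deriv_mul (a := a) (b := b)
    (u := fun x => ∫ t in a..x, f t) (u' := f) (v := fun x => V.eval x)
    (v' := fun x => w.eval x)
    (fun x _ => intervalIntegral.integral_hasDerivAt_right (hf.intervalIntegrable _ _)
      (hf.stronglyMeasurableAtFilter _ _) hf.continuousAt)
    (fun x _ => by rw [← hV]; exact V.hasDerivAt x)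
    (hf.intervalIntegrable _ _) (w.continuous.intervalIntegrable _ _)
  simp only [h1, h2, intervalIntegral.integral_same, zero_mul, sub_zero] at key
  simp only [Dinv, mul_assoc]
  rw [intervalIntegral.integral_const_mul, key, mul_zero]

lemma aux_rodrigues (n : ℕ) (p : Polynomial ℝ)
    (hp : (Polynomial.X ^ 2 - 1 : Polynomial ℝ) ^ n ∣ p) (j : ℕ) (hj : j ≤ n) :
    auxOrth (-1) 1 (fun x => (Polynomial.derivative^[j] p).eval x) j := by
  induction j with
  | zero => intro w hw; omega
  | succ j ih =>
    intro w hw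
    have hroot : ∀ s : ℝ, s ^ 2 = 1 → (Polynomial.derivative^[j] p).eval s = 0 := by
      intro s hs
      have hd := Polynomial.pow_sub_dvd_iterate_derivative_of_pow_dvd j hp
      have hd2 := (dvd_pow_self (Polynomial.X ^ 2 - 1 : Polynomial ℝ)
        (show n - j ≠ 0 by omega)).trans hd
      obtain ⟨q, hq⟩ := hd2
      rw [hq]
      simp [hs]
    have key := intervalIntegral.integral_mul_deriv_eq_deriv_mul (a := (-1 : ℝ)) (b := 1)
      (u := fun x => w.eval x) (u' := fun x => w.derivative.eval x)
      (v := fun x => (Polynomial.derivative^[j] p).eval x)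
      (v' := fun x => (Polynomial.derivative^[j + 1] p).eval x)
      (fun x _ => w.hasDerivAt x)
      (fun x _ => by
        rw [Function.iterate_succ_apply']; exact (Polynomial.derivative^[j] p).hasDerivAt x)
      (w.derivative.continuous.intervalIntegrable _ _)
      ((Polynomial.derivative^[j + 1] p).continuous.intervalIntegrable _ _)
    have hz : (∫ x in (-1 : ℝ)..1, w.derivative.eval x *
        (Polynomial.derivative^[j] p).eval x) = 0 := by
      rcases Nat.eq_zero_or_pos w.natDegree with h0 | h0
      · rw [Polynomial.derivative_of_natDegree_zero h0]; simp
      · have := ih (by omega) w.derivative (by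
          have := Polynomial.natDegree_derivative_lt (p := w) (by omega)
          omega)
        simpa only [mul_comm] using this
    rw [hz, hroot 1 (by norm_num), hroot (-1) (by norm_num)] at key
    simp only [mul_comm (Polynomial.eval _ (Polynomial.derivative^[j + 1] p))]
    simpa using key

lemma aux_iteratedDeriv (p : Polynomial ℝ) (m : ℕ) :
    iteratedDeriv m (fun t => p.eval t) = fun t => (Polynomial.derivative^[m] p).eval t := by
  induction m with
  | zero => simp
  | succ m ih =>
    rw [iteratedDeriv_succ, ih, Function.iterate_succ_apply']
    funext t
    exact Polynomial.deriv _

lemma aux_legendreP (m : ℕ) : legendreP m = fun s =>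
    (1 / ((2:ℝ) ^ m * (Nat.factorial m : ℝ))) *
      (Polynomial.derivative^[m] ((Polynomial.X ^ 2 - 1 : Polynomial ℝ) ^ m)).eval s := by
  funext s
  have := congrFun (aux_iteratedDeriv ((Polynomial.X ^ 2 - 1 : Polynomial ℝ) ^ m) m) s
  simp only [legendreP]
  rw [← this]
  simp

lemma aux_legendreCell_cont (k : ℕ) (a b : ℝ) : Continuous (legendreCell k a b) := by
  unfold legendreCell
  rw [aux_legendreP]
  fun_prop

lemma aux_legendreCell (k : ℕ) (a b : ℝ) (hab : a < b) :
    auxOrth a b (legendreCell k a b) k := by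
  intro w hw
  have hne : b - a ≠ 0 := by linarith
  set q : Polynomial ℝ := Polynomial.C ((b - a) / 2) * Polynomial.X + Polynomial.C ((a + b) / 2)
    with hq
  have hqd : (w.comp q).natDegree + 1 ≤ k := by
    have h1 : q.natDegree ≤ 1 := Polynomial.natDegree_linear_le
    have h2 := Polynomial.natDegree_comp (p := w) (q := q)
    have h3 := Nat.mul_le_mul_left w.natDegree h1
    omega
  have h := aux_rodrigues k _ dvd_rfl k le_rfl (w.comp q) hqd
  have hs := intervalIntegral.integral_comp_mul_add (a := a) (b := b)
    (fun s => legendreP k s * (w.comp q).eval s) (c := 2 / (b - a)) (div_ne_zero two_ne_zero hne)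
    (-(a + b) / (b - a))
  have e1 : 2 / (b - a) * a + -(a + b) / (b - a) = -1 := by field_simp; ring
  have e2 : 2 / (b - a) * b + -(a + b) / (b - a) = 1 := by field_simp; ring
  rw [e1, e2] at hs
  have hz : (∫ s in (-1 : ℝ)..1, legendreP k s * (w.comp q).eval s) = 0 := by
    rw [aux_legendreP]
    simp only [mul_assoc]
    rw [intervalIntegral.integral_const_mul, h, mul_zero]
  rw [hz, smul_zero] at hs
  rw [← hs]
  congr 1
  funext x
  have e3 : 2 / (b - a) * x + -(a + b) / (b - a) = (2 * x - (a + b)) / (b - a) := by ring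
  have e4 : q.eval ((2 * x - (a + b)) / (b - a)) = x := by
    simp only [hq, Polynomial.eval_add, Polynomial.eval_mul, Polynomial.eval_C, Polynomial.eval_X]
    field_simp
    ring
  rw [e3, Polynomial.eval_comp, e4]
  rfl

lemma aux_main (k : ℕ) (a b : ℝ) (hab : a < b)
    (F : ℕ → Polynomial ℝ) (hF : IsFSeq k a b F) (i : ℕ) :
    ∀ m, m + (i + 1) = k → auxOrth a b (fun x => (F (i + 1)).eval x) m := by
  induction i with
  | zero =>
    intro m hm w hw
    have h := aux_Dinv a b _ (aux_legendreCell_cont k a b) m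
      (by rw [show m + 1 = k by omega]; exact aux_legendreCell k a b hab) w hw
    exact (hF.1.2.1 w (by omega)).trans h
  | succ i ih =>
    intro m hm w hw
    have h := aux_Dinv a b _ (F (i + 1)).continuous m (ih (m + 1) (by omega)) w hw
    have h2 := ((hF.2 (i + 1 + 1) (by omega)).2.1 w (by omega)).trans h
    simpa using h2

/-- `F_i` is orthogonal to all polynomials of degree ≤ k - i - 1. -/
theorem stmt6 (k : ℕ) (hk : 1 ≤ k) (a b : ℝ) (hab : a < b)
    (F : ℕ → Polynomial ℝ) (hF : IsFSeq k a b F)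
    (i : ℕ) (hi1 : 1 ≤ i) (hik : i ≤ k)
    (v : Polynomial ℝ) (hv : v.natDegree + i + 1 ≤ k) :
    (∫ y in a..b, (F i).eval y * v.eval y) = 0 := by
  obtain ⟨n, rfl⟩ : ∃ n, i = n + 1 := ⟨i - 1, by omega⟩
  exact aux_main k a b hab F hF n (k - (n + 1)) (by omega) v (by omega)
end
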